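/- arXiv:2605.04258 — 2 statements merged into one kernel-verified Lean document; each statement's English description precedes it below -/
import Mathlib

section
/- For every index x with 1 < x ≤ n such that BWT[x] ≠ BWT[x-1], and every character c ∈ {BWT[x], BWT[x-1]}, there exists an index y with b(x) ≤ y < e(x), BWT[y] = c and w(y) ≥ 0; consequently Candt_c(b(x), e(x)) ≠ -1. -/
open scoped Classical

/-- `seg T i len` is the string `T[i..i+len-1]`. -/
def seg (T : ℕ → ℤ) (i len : ℕ) : List ℤ :=
  (List.range len).map fun k => T (i + k)

/-- `sfx T n p` is the suffix `T[p..n]` of a length-`n` text. -/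
def sfx (T : ℕ → ℤ) (n p : ℕ) : List ℤ := seg T p (n + 1 - p)

/-- The reversed text: `Trev T n n = T n` and `Trev T n i = T (n - i)` for `i < n`. -/
def Trev (T : ℕ → ℤ) (n : ℕ) : ℕ → ℤ := fun i => if i = n then T n else T (n - i)

/-- Length of the longest common prefix of two strings. -/
def lcpLen : List ℤ → List ℤ → ℕ
  | a :: l₁, b :: l₂ => if a = b then lcpLen l₁ l₂ + 1 else 0
  | _, _ => 0

/-- `s` occurs as a substring of `T[1..n]`. -/
def OccursIn (T : ℕ → ℤ) (n : ℕ) (s : List ℤ) : Prop :=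
  ∃ i : ℕ, 1 ≤ i ∧ i + s.length ≤ n + 1 ∧ s = seg T i s.length

/-- `s` is a right-maximal substring of `T[1..n]` over the alphabet `{1,…,σ}`. -/
def RightMax (T : ℕ → ℤ) (n σ : ℕ) (s : List ℤ) : Prop :=
  ∃ a b : ℤ, a ≠ b ∧ 1 ≤ a ∧ a ≤ (σ : ℤ) ∧ 1 ≤ b ∧ b ≤ (σ : ℤ) ∧
    OccursIn T n (s ++ [a]) ∧ OccursIn T n (s ++ [b])

/-- `X` is a suffixient set for `T[1..n]`. -/
def Suffixient (T : ℕ → ℤ) (n σ : ℕ) (X : Set ℕ) : Prop :=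
  ∀ s : List ℤ, RightMax T n σ s → ∀ c : ℤ, 1 ≤ c → c ≤ (σ : ℤ) →
    OccursIn T n (s ++ [c]) → ∃ x ∈ X, (s ++ [c]) <:+ seg T 1 x

def StartRun (BWT : ℕ → ℤ) (x : ℕ) : Prop := 1 < x ∧ BWT x ≠ BWT (x - 1)

def EndRun (BWT : ℕ → ℤ) (n x : ℕ) : Prop := x < n ∧ BWT x ≠ BWT (x + 1)

def RunBoundary (BWT : ℕ → ℤ) (n x : ℕ) : Prop := StartRun BWT x ∨ EndRun BWT n x

/-- `bIdx L x` : the largest index `y < x` with `L y < L x`, or `1` if none exists. -/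
noncomputable def bIdx (L : ℕ → ℤ) (x : ℕ) : ℕ :=
  sSup {y : ℕ | (1 ≤ y ∧ y < x ∧ L y < L x) ∨ y = 1}

/-- `eIdx L n x` : the smallest index `y > x` with `L y < L x`, or `n+1` if none exists. -/
noncomputable def eIdx (L : ℕ → ℤ) (n x : ℕ) : ℕ :=
  sInf {y : ℕ | (x < y ∧ y ≤ n ∧ L y < L x) ∨ y = n + 1}

/-- The maximal weight `w y` over indices `a ≤ y < a'` with `BWT y = c` and `w y ≥ 0`. -/
noncomputable def wMax (BWT w : ℕ → ℤ) (c : ℤ) (a a' : ℕ) : ℤ :=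
  (sSup {m : ℕ | ∃ q : ℕ, a ≤ q ∧ q < a' ∧ BWT q = c ∧ 0 ≤ w q ∧ (m : ℤ) = w q} : ℕ)

/-- `Candt BWT w c a a'`: the smallest index `a ≤ p < a'` with `BWT p = c` whose weight
attains the maximum weight among such indices; `-1` if no index
`a ≤ y < a'` with `BWT y = c` and `w y ≥ 0` exists. -/
noncomputable def Candt (BWT w : ℕ → ℤ) (c : ℤ) (a a' : ℕ) : ℤ :=
  if ∃ p : ℕ, a ≤ p ∧ p < a' ∧ BWT p = c ∧ 0 ≤ w p then
    ((sInf {p : ℕ | a ≤ p ∧ p < a' ∧ BWT p = c ∧ w p = wMax BWT w c a a'} : ℕ) : ℤ)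
  else -1

def FullL (n : ℕ) (SA : ℕ → ℕ) (BWT LCP w : ℕ → ℤ) : Set ℕ :=
  { q | ∃ x : ℕ, 1 < x ∧ x ≤ n ∧ BWT x ≠ BWT (x - 1) ∧
      ∃ c : ℤ, (c = BWT x ∨ c = BWT (x - 1)) ∧
      ∃ p : ℕ, (p : ℤ) = Candt BWT w c (bIdx LCP x) (eIdx LCP n x) ∧
        q = n - SA p + 1 }

/-- Basic assumptions on the text `T[1..n]` over alphabet `{1,…,σ}` with sentinel `dollar`. -/
structure TextSetup (n σ : ℕ) (T : ℕ → ℤ) (dollar : ℤ) : Prop where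
  hn : 2 ≤ n
  hsigma : 2 ≤ σ
  hsigma_le : σ ≤ n
  hT : ∀ i, 1 ≤ i → i ≤ n → 1 ≤ T i ∧ T i ≤ (σ : ℤ)
  hTn : T n = dollar
  hTne : ∀ i, 1 ≤ i → i < n → T i ≠ dollar

/-- `SA[1..n]` is the suffix array of the reversed text. -/
structure SASetup (n σ : ℕ) (T : ℕ → ℤ) (dollar : ℤ) (SA : ℕ → ℕ)
    extends TextSetup n σ T dollar : Prop where
  hSAmem : ∀ i, 1 ≤ i → i ≤ n → 1 ≤ SA i ∧ SA i ≤ n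
  hSAinj : ∀ i j, 1 ≤ i → i ≤ n → 1 ≤ j → j ≤ n → SA i = SA j → i = j
  hSAsurj : ∀ p, 1 ≤ p → p ≤ n → ∃ i, 1 ≤ i ∧ i ≤ n ∧ SA i = p
  hSAord : ∀ i j, 1 ≤ i → i < j → j ≤ n →
    List.Lex (· < ·) (sfx (Trev T n) n (SA i)) (sfx (Trev T n) n (SA j))

/-- `LCP[1..n]` is the LCP array of the reversed text. -/
structure LCPSetup (n σ : ℕ) (T : ℕ → ℤ) (dollar : ℤ) (SA : ℕ → ℕ) (LCP : ℕ → ℤ)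
    extends SASetup n σ T dollar SA : Prop where
  hLCP1 : LCP 1 = -1
  hLCP : ∀ i, 1 < i → i ≤ n →
    LCP i = (lcpLen (sfx (Trev T n) n (SA (i - 1))) (sfx (Trev T n) n (SA i)) : ℤ)
  hLCPend : LCP (n + 1) = -1

/-- Additionally, `BWT[1..n]` is the BWT of the reversed text and `w` is the weight function. -/
structure FullSetup (n σ : ℕ) (T : ℕ → ℤ) (dollar : ℤ) (SA : ℕ → ℕ)
    (BWT LCP w : ℕ → ℤ) extends LCPSetup n σ T dollar SA LCP : Prop where
  hBWT : ∀ i, 1 ≤ i → i ≤ n → BWT i = T (n - SA i + 1)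
  hBWTend : BWT (n + 1) = -1
  hwNot : ∀ x, 1 ≤ x → x ≤ n → ¬ RunBoundary BWT n x → w x = -1
  hwRB : ∀ x, 1 ≤ x → x ≤ n → RunBoundary BWT n x →
    (∃ s : List ℤ, RightMax T n σ s ∧ s <:+ seg T 1 (n - SA x)) →
    IsGreatest {m : ℤ | ∃ s : List ℤ, RightMax T n σ s ∧ s <:+ seg T 1 (n - SA x) ∧
      m = (s.length : ℤ)} (w x)

/-- `sIdx`: the minimum index `i ∈ [1..n]` such that `T[n-SA[ℓ]+1-w(ℓ)..n-SA[ℓ]]`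
is a suffix of `T[1..n-SA[i]]`. -/
noncomputable def sIdx (T : ℕ → ℤ) (n : ℕ) (SA : ℕ → ℕ) (w : ℕ → ℤ) (l : ℕ) : ℕ :=
  sInf {i : ℕ | 1 ≤ i ∧ i ≤ n ∧
    seg T (n - SA l + 1 - (w l).toNat) (w l).toNat <:+ seg T 1 (n - SA i)}

/-- `tIdx`: the maximum such index. -/
noncomputable def tIdx (T : ℕ → ℤ) (n : ℕ) (SA : ℕ → ℕ) (w : ℕ → ℤ) (l : ℕ) : ℕ :=
  sSup {i : ℕ | 1 ≤ i ∧ i ≤ n ∧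
    seg T (n - SA l + 1 - (w l).toNat) (w l).toNat <:+ seg T 1 (n - SA i)}

/-- `pIdx c i`: the largest index `j < i` with `w j > -1` and `BWT j = c`, or `0`. -/
noncomputable def pIdx (BWT w : ℕ → ℤ) (c : ℤ) (i : ℕ) : ℕ :=
  sSup {j : ℕ | (1 ≤ j ∧ j < i ∧ -1 < w j ∧ BWT j = c) ∨ j = 0}

/-- `pW c i`: the weight of `pIdx c i`, or `-1` if no index as in `pIdx` exists. -/
noncomputable def pW (BWT w : ℕ → ℤ) (c : ℤ) (i : ℕ) : ℤ :=
  if ∃ j : ℕ, 1 ≤ j ∧ j < i ∧ -1 < w j ∧ BWT j = c then w (pIdx BWT w c i) else -1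

/-- `α` is colexicographically smaller than `β`. -/
def ColexLt (α β : List ℤ) : Prop :=
  (α ≠ β ∧ α <:+ β) ∨
  ∃ k : ℕ, 1 ≤ k ∧ k ≤ α.length ∧ k ≤ β.length ∧
    (∀ i, 1 ≤ i → i < k → α.getD (α.length - i) 0 = β.getD (β.length - i) 0) ∧
    α.getD (α.length - k) 0 < β.getD (β.length - k) 0

theorem occursIn_singleton (T : ℕ → ℤ) (n i : ℕ) (h1 : 1 ≤ i) (hn : i ≤ n) :
    OccursIn T n ([] ++ [T i]) :=
  ⟨i, h1, by simpa using hn, by simp [seg]⟩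

theorem TextSetup.rightMax_nil {n σ : ℕ} {T : ℕ → ℤ} {dollar : ℤ}
    (h : TextSetup n σ T dollar) : RightMax T n σ [] := by
  have hn := h.hn
  have h1 := h.hT 1 le_rfl (by omega)
  have hlast := h.hT n (by omega) le_rfl
  refine ⟨T 1, T n, ?_, h1.1, h1.2, hlast.1, hlast.2,
    occursIn_singleton T n 1 le_rfl (by omega), occursIn_singleton T n n (by omega) le_rfl⟩
  rw [h.hTn]
  exact h.hTne 1 le_rfl (by omega)

theorem FullSetup.weight_nonneg {n σ : ℕ} {T : ℕ → ℤ} {dollar : ℤ} {SA : ℕ → ℕ}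
    {BWT LCP w : ℕ → ℤ} (h : FullSetup n σ T dollar SA BWT LCP w) {x : ℕ}
    (hx1 : 1 ≤ x) (hxn : x ≤ n) (hx : RunBoundary BWT n x) : 0 ≤ w x := by
  have hnil := h.toTextSetup.rightMax_nil
  exact (h.hwRB x hx1 hxn hx ⟨[], hnil, List.nil_suffix⟩).2
    ⟨[], hnil, List.nil_suffix, by simp⟩

theorem bIdx_le_pred (L : ℕ → ℤ) {x : ℕ} (hx : 1 < x) : bIdx L x ≤ x - 1 := by
  refine csSup_le ⟨1, Or.inr rfl⟩ ?_
  rintro y (⟨-, hy, -⟩ | rfl) <;> omega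

theorem lt_eIdx (L : ℕ → ℤ) {n x : ℕ} (hx : x ≤ n) : x < eIdx L n x := by
  refine Nat.lt_of_succ_le (le_csInf ⟨n + 1, Or.inr rfl⟩ ?_)
  rintro y (⟨hy, -, -⟩ | rfl) <;> omega

theorem Candt_ne_neg_one {BWT w : ℕ → ℤ} {c : ℤ} {a a' : ℕ}
    (h : ∃ y : ℕ, a ≤ y ∧ y < a' ∧ BWT y = c ∧ 0 ≤ w y) : Candt BWT w c a a' ≠ -1 := by
  rw [Candt, if_pos h]
  omega

/-- For every index `x` with `1 < x ≤ n` such that `BWT[x] ≠ BWT[x-1]`, and every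
character `c ∈ {BWT[x], BWT[x-1]}`, there exists an index `y` with `b(x) ≤ y < e(x)`,
`BWT[y] = c` and `w(y) ≥ 0`; consequently `Candt_c(b(x), e(x)) ≠ -1`. -/
theorem stmt0 (n σ : ℕ) (T : ℕ → ℤ) (dollar : ℤ) (SA : ℕ → ℕ) (BWT LCP w : ℕ → ℤ)
    (hsetup : FullSetup n σ T dollar SA BWT LCP w)
    (x : ℕ) (hx1 : 1 < x) (hxn : x ≤ n) (hrun : BWT x ≠ BWT (x - 1))
    (c : ℤ) (hc : c = BWT x ∨ c = BWT (x - 1)) :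
    (∃ y : ℕ, bIdx LCP x ≤ y ∧ y < eIdx LCP n x ∧ BWT y = c ∧ 0 ≤ w y) ∧
      Candt BWT w c (bIdx LCP x) (eIdx LCP n x) ≠ -1 := by
  have hb := bIdx_le_pred LCP hx1
  have he := lt_eIdx LCP hxn
  have key : ∃ y : ℕ, bIdx LCP x ≤ y ∧ y < eIdx LCP n x ∧ BWT y = c ∧ 0 ≤ w y := by
    rcases hc with rfl | rfl
    · exact ⟨x, by omega, he, rfl, hsetup.weight_nonneg hx1.le hxn (Or.inl ⟨hx1, hrun⟩)⟩
    · refine ⟨x - 1, hb, by omega, rfl,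
        hsetup.weight_nonneg (by omega) (by omega) (Or.inr ⟨by omega, ?_⟩)⟩
      rw [Nat.sub_add_cancel hx1.le]
      exact hrun.symm
  exact ⟨key, Candt_ne_neg_one key⟩
end

section
/- Let x be an index with 1 < x ≤ n and BWT[x] ≠ BWT[x-1], let c ∈ {BWT[x], BWT[x-1]}, and let ℓ := Candt_c(b(x), e(x)). Then s(ℓ) ≥ b(x) and t(ℓ) < e(x); that is, the interval [s(ℓ), t(ℓ)] is contained in [b(x), e(x)). -/
open scoped Classical

theorem seg_length (T : ℕ → ℤ) (i k : ℕ) : (seg T i k).length = k := by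
  simp [seg]

theorem seg_getElem (T : ℕ → ℤ) (i k j : ℕ) (h : j < (seg T i k).length) :
    (seg T i k)[j] = T (i + j) := by
  simp [seg]

theorem seg_eq_iff (T U : ℕ → ℤ) (i j k : ℕ) :
    seg T i k = seg U j k ↔ ∀ m < k, T (i + m) = U (j + m) := by
  simp [seg]

theorem seg_succ (T : ℕ → ℤ) (i k : ℕ) : seg T i (k + 1) = seg T i k ++ [T (i + k)] := by
  simp [seg, List.range_succ]

theorem drop_seg (T : ℕ → ℤ) (i k d : ℕ) : (seg T i k).drop d = seg T (i + d) (k - d) := by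
  apply List.ext_getElem
  · simp [seg_length]
  · intro m h₁ h₂
    simp [seg_getElem, add_assoc]

theorem take_seg (T : ℕ → ℤ) (i k d : ℕ) (h : d ≤ k) : (seg T i k).take d = seg T i d := by
  apply List.ext_getElem
  · simp [seg_length, h]
  · intro m h₁ h₂
    simp [seg_getElem]

/-- `T[1..M]` and `T[1..N]` have a common suffix of length `k`. -/
def CommonSuffix (T : ℕ → ℤ) (M N k : ℕ) : Prop :=
  k ≤ M ∧ k ≤ N ∧ ∀ j < k, T (M - j) = T (N - j)

theorem CommonSuffix.refl (T : ℕ → ℤ) {M k : ℕ} (h : k ≤ M) : CommonSuffix T M M k :=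
  ⟨h, h, fun _ _ => rfl⟩

theorem CommonSuffix.symm {T : ℕ → ℤ} {M N k : ℕ} (h : CommonSuffix T M N k) :
    CommonSuffix T N M k :=
  ⟨h.2.1, h.1, fun j hj => (h.2.2 j hj).symm⟩

theorem CommonSuffix.trans {T : ℕ → ℤ} {M N P k : ℕ} (h₁ : CommonSuffix T M N k)
    (h₂ : CommonSuffix T N P k) : CommonSuffix T M P k :=
  ⟨h₁.1, h₂.2.1, fun j hj => (h₁.2.2 j hj).trans (h₂.2.2 j hj)⟩

theorem CommonSuffix.mono {T : ℕ → ℤ} {M N k m : ℕ} (h : CommonSuffix T M N k) (hm : m ≤ k) :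
    CommonSuffix T M N m :=
  ⟨hm.trans h.1, hm.trans h.2.1, fun j hj => h.2.2 j (hj.trans_le hm)⟩

theorem CommonSuffix.seg_eq {T : ℕ → ℤ} {M N k : ℕ} (h : CommonSuffix T M N k) :
    seg T (M + 1 - k) k = seg T (N + 1 - k) k := by
  obtain ⟨hM, hN, h⟩ := h
  rw [seg_eq_iff]
  intro m hm
  have := h (k - 1 - m) (by omega)
  rwa [show M - (k - 1 - m) = M + 1 - k + m by omega,
    show N - (k - 1 - m) = N + 1 - k + m by omega] at this

theorem seg_isSuffix_iff (T : ℕ → ℤ) {N k : ℕ} (hk : k ≤ N) (M : ℕ) :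
    seg T (N + 1 - k) k <:+ seg T 1 M ↔ CommonSuffix T N M k := by
  constructor
  · intro h
    have hl := h.length_le
    rw [seg_length, seg_length] at hl
    have he := List.suffix_iff_eq_drop.1 h
    rw [drop_seg, seg_length, seg_length, show M - (M - k) = k by omega, seg_eq_iff] at he
    refine ⟨hk, hl, fun j hj => ?_⟩
    have := he (k - 1 - j) (by omega)
    rwa [show N + 1 - k + (k - 1 - j) = N - j by omega,
      show 1 + (M - k) + (k - 1 - j) = M - j by omega] at this
  · intro h
    have hM := h.2.1
    rw [h.seg_eq, List.suffix_iff_eq_drop, drop_seg, seg_length, seg_length,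
      show M - (M - k) = k by omega, show 1 + (M - k) = M + 1 - k by omega]

theorem le_lcpLen_iff (k : ℕ) (u v : List ℤ) :
    k ≤ lcpLen u v ↔ k ≤ u.length ∧ k ≤ v.length ∧ u.take k = v.take k := by
  induction k generalizing u v with
  | zero => simp
  | succ k ih =>
    cases u with
    | nil => simp [lcpLen]
    | cons a u =>
      cases v with
      | nil => simp [lcpLen]
      | cons b v =>
        by_cases hab : a = b
        · simp [lcpLen, hab, ih]
        · simp [lcpLen, hab]

theorem take_eq_of_lex_between (k : ℕ) {u v z : List ℤ} (huv : List.Lex (· < ·) u v)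
    (hvz : List.Lex (· < ·) v z) (h : u.take k = z.take k) : v.take k = u.take k := by
  induction k generalizing u v z with
  | zero => simp
  | succ k ih =>
    cases huv with
    | nil =>
      cases z with
      | nil => cases hvz
      | cons b z => simp at h
    | cons huv =>
      cases hvz with
      | cons hvz =>
        simp only [List.take_succ_cons, List.cons.injEq, true_and] at h ⊢
        exact ih huv hvz h
      | rel hr =>
        simp only [List.take_succ_cons, List.cons.injEq] at h
        exact absurd h.1 hr.ne
    | rel hr =>
      cases hvz with
      | cons hvz =>
        simp only [List.take_succ_cons, List.cons.injEq] at h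
        exact absurd h.1 hr.ne
      | rel hr' =>
        simp only [List.take_succ_cons, List.cons.injEq] at h
        exact absurd h.1 (hr.trans hr').ne

theorem length_sfx (U : ℕ → ℤ) (n p : ℕ) : (sfx U n p).length = n + 1 - p := seg_length _ _ _

theorem CommonSuffix.take_sfx_eq {T : ℕ → ℤ} {n p q k : ℕ} (hp : p ≤ n) (hq : q ≤ n)
    (h : CommonSuffix T (n - p) (n - q) k) :
    (sfx (Trev T n) n p).take k = (sfx (Trev T n) n q).take k := by
  obtain ⟨h₁, h₂, h⟩ := h
  rw [sfx, sfx, take_seg _ _ _ _ (by omega), take_seg _ _ _ _ (by omega), seg_eq_iff]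
  intro m hm
  have := h m hm
  rw [Trev, Trev, if_neg (by omega), if_neg (by omega), ← Nat.sub_sub, ← Nat.sub_sub, this]

/-- A common prefix of two distinct suffixes of the reversed text avoids the sentinel. -/
theorem TextSetup.commonSuffix_of_take_sfx_eq {n σ : ℕ} {T : ℕ → ℤ} {dollar : ℤ}
    (hT : TextSetup n σ T dollar) {p q k : ℕ} (hp : 1 ≤ p) (hpn : p ≤ n) (hq : 1 ≤ q)
    (hqn : q ≤ n) (hpq : p ≠ q) (hkp : k ≤ n + 1 - p) (hkq : k ≤ n + 1 - q)
    (h : (sfx (Trev T n) n p).take k = (sfx (Trev T n) n q).take k) :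
    CommonSuffix T (n - p) (n - q) k := by
  rw [sfx, sfx, take_seg _ _ _ _ hkp, take_seg _ _ _ _ hkq, seg_eq_iff] at h
  have hp' : k ≤ n - p := by
    by_contra! hlt
    have := h (n - p) hlt
    rw [Trev, Trev, if_pos (by omega), if_neg (by omega), hT.hTn] at this
    exact hT.hTne _ (by omega) (by omega) this.symm
  have hq' : k ≤ n - q := by
    by_contra! hlt
    have := h (n - q) hlt
    rw [Trev, Trev, if_neg (by omega), if_pos (by omega), hT.hTn] at this
    exact hT.hTne _ (by omega) (by omega) this
  refine ⟨hp', hq', fun m hm => ?_⟩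
  have := h m hm
  rwa [Trev, Trev, if_neg (by omega), if_neg (by omega), ← Nat.sub_sub, ← Nat.sub_sub] at this

theorem LCPSetup.le_LCP_iff {n σ : ℕ} {T : ℕ → ℤ} {dollar : ℤ} {SA : ℕ → ℕ} {LCP : ℕ → ℤ}
    (hS : LCPSetup n σ T dollar SA LCP) {y : ℕ} (hy : 1 < y) (hyn : y ≤ n) (k : ℕ) :
    (k : ℤ) ≤ LCP y ↔ CommonSuffix T (n - SA (y - 1)) (n - SA y) k := by
  obtain ⟨h₁, h₂⟩ := hS.hSAmem y (by omega) hyn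
  obtain ⟨h₃, h₄⟩ := hS.hSAmem (y - 1) (by omega) (by omega)
  rw [hS.hLCP y hy hyn, Int.ofNat_le, le_lcpLen_iff, length_sfx, length_sfx]
  constructor
  · rintro ⟨hk, hk', h⟩
    refine hS.commonSuffix_of_take_sfx_eq h₃ h₄ h₁ h₂ (fun he => ?_) hk hk' h
    have := hS.hSAinj (y - 1) y (by omega) (by omega) (by omega) hyn he
    omega
  · intro h
    have := h.1
    have := h.2.1
    exact ⟨by omega, by omega, h.take_sfx_eq h₄ h₂⟩

/-- Indices whose suffixes share a prefix of length `k` bound a block of LCP values `≥ k`. -/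
theorem LCPSetup.le_LCP_of_commonSuffix {n σ : ℕ} {T : ℕ → ℤ} {dollar : ℤ} {SA : ℕ → ℕ}
    {LCP : ℕ → ℤ} (hS : LCPSetup n σ T dollar SA LCP) {i j y k : ℕ} (hi : 1 ≤ i) (hiy : i < y)
    (hyj : y ≤ j) (hj : j ≤ n) (h : CommonSuffix T (n - SA i) (n - SA j) k) :
    (k : ℤ) ≤ LCP y := by
  have mem := fun z (hz : i ≤ z ∧ z ≤ j) => hS.hSAmem z (hi.trans hz.1) (hz.2.trans hj)
  have hij := h.take_sfx_eq (mem i (by omega)).2 (mem j (by omega)).2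
  have between : ∀ z, i ≤ z → z ≤ j → CommonSuffix T (n - SA i) (n - SA z) k := by
    intro z hiz hzj
    rcases hiz.eq_or_lt with rfl | hiz
    · exact .refl T h.1
    rcases hzj.eq_or_lt with rfl | hzj
    · exact h
    have hz := take_eq_of_lex_between k (hS.hSAord i z hi hiz (by omega))
      (hS.hSAord z j (by omega) hzj hj) hij
    have hlen := congrArg List.length hz
    rw [List.length_take, List.length_take, length_sfx, length_sfx] at hlen
    have hk := h.1
    have h₁ := mem i (by omega)
    have h₂ := mem z (by omega)
    refine hS.commonSuffix_of_take_sfx_eq h₁.1 h₁.2 h₂.1 h₂.2 (fun he => ?_) (by omega)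
      (by omega) hz.symm
    have := hS.hSAinj i z hi (by omega) (by omega) (by omega) he
    omega
  rw [hS.le_LCP_iff (by omega) (by omega)]
  exact (between (y - 1) (by omega) (by omega)).symm.trans (between y (by omega) hyj)

theorem FullSetup.BWT_mem {n σ : ℕ} {T : ℕ → ℤ} {dollar : ℤ} {SA : ℕ → ℕ}
    {BWT LCP w : ℕ → ℤ} (hS : FullSetup n σ T dollar SA BWT LCP w) {y : ℕ} (hy : 1 ≤ y)
    (hyn : y ≤ n) : 1 ≤ BWT y ∧ BWT y ≤ (σ : ℤ) := by
  have := hS.hSAmem y hy hyn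
  rw [hS.hBWT y hy hyn]
  exact hS.hT _ (by omega) (by omega)

theorem FullSetup.occursIn {n σ : ℕ} {T : ℕ → ℤ} {dollar : ℤ} {SA : ℕ → ℕ}
    {BWT LCP w : ℕ → ℤ} (hS : FullSetup n σ T dollar SA BWT LCP w) {y k : ℕ} (hy : 1 ≤ y)
    (hyn : y ≤ n) (hk : k ≤ n - SA y) :
    OccursIn T n (seg T (n - SA y + 1 - k) k ++ [BWT y]) := by
  have := hS.hSAmem y hy hyn
  refine ⟨n - SA y + 1 - k, by omega, by simp [seg_length]; omega, ?_⟩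
  rw [List.length_append, seg_length, List.length_singleton, seg_succ, hS.hBWT y hy hyn,
    show n - SA y + 1 - k + k = n - SA y + 1 by omega]

theorem FullSetup.rightMax {n σ : ℕ} {T : ℕ → ℤ} {dollar : ℤ} {SA : ℕ → ℕ}
    {BWT LCP w : ℕ → ℤ} (hS : FullSetup n σ T dollar SA BWT LCP w) {y z k : ℕ} (hy : 1 ≤ y)
    (hyn : y ≤ n) (hz : 1 ≤ z) (hzn : z ≤ n) (hyz : BWT y ≠ BWT z)
    (h : CommonSuffix T (n - SA y) (n - SA z) k) :
    RightMax T n σ (seg T (n - SA y + 1 - k) k) := by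
  obtain ⟨h₁, h₂⟩ := hS.BWT_mem hy hyn
  obtain ⟨h₃, h₄⟩ := hS.BWT_mem hz hzn
  refine ⟨BWT y, BWT z, hyz, h₁, h₂, h₃, h₄, hS.occursIn hy hyn h.1, ?_⟩
  rw [h.seg_eq]
  exact hS.occursIn hz hzn h.2.1

theorem FullSetup.le_weight {n σ : ℕ} {T : ℕ → ℤ} {dollar : ℤ} {SA : ℕ → ℕ}
    {BWT LCP w : ℕ → ℤ} (hS : FullSetup n σ T dollar SA BWT LCP w) {y z k : ℕ} (hy : 1 ≤ y)
    (hyn : y ≤ n) (hz : 1 ≤ z) (hzn : z ≤ n) (hyz : BWT y ≠ BWT z)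
    (hb : RunBoundary BWT n y) (h : CommonSuffix T (n - SA y) (n - SA z) k) :
    (k : ℤ) ≤ w y := by
  have hr := hS.rightMax hy hyn hz hzn hyz h
  have hs := (seg_isSuffix_iff T h.1 (n - SA y)).2 (.refl T h.1)
  exact (hS.hwRB y hy hyn hb ⟨_, hr, hs⟩).2 ⟨_, hr, hs, by rw [seg_length]⟩

theorem FullSetup.weight_le {n σ : ℕ} {T : ℕ → ℤ} {dollar : ℤ} {SA : ℕ → ℕ}
    {BWT LCP w : ℕ → ℤ} (hS : FullSetup n σ T dollar SA BWT LCP w) {y : ℕ} (hy : 1 ≤ y)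
    (hyn : y ≤ n) : (w y).toNat ≤ n - SA y := by
  by_cases hb : RunBoundary BWT n y
  · obtain ⟨z, hz, hzn, hyz⟩ : ∃ z, 1 ≤ z ∧ z ≤ n ∧ BWT y ≠ BWT z := by
      rcases hb with ⟨h, h'⟩ | ⟨h, h'⟩
      · exact ⟨y - 1, by omega, by omega, h'⟩
      · exact ⟨y + 1, by omega, by omega, h'⟩
    have hr := hS.rightMax hy hyn hz hzn hyz (k := 0) ⟨by omega, by omega, by simp⟩
    obtain ⟨s, -, hs, hw⟩ := (hS.hwRB y hy hyn hb ⟨_, hr, by simp [seg]⟩).1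
    have := hs.length_le
    rw [seg_length] at this
    omega
  · simp [hS.hwNot y hy hyn hb]

/-- If some admissible index exists, then `Candt` is admissible and of maximal weight. -/
theorem Candt_spec {BWT w : ℕ → ℤ} {c : ℤ} {a a' l p : ℕ} (hl : (l : ℤ) = Candt BWT w c a a')
    (hap : a ≤ p) (hpa : p < a') (hpc : BWT p = c) (hwp : 0 ≤ w p) :
    a ≤ l ∧ l < a' ∧ w p ≤ w l := by
  rw [Candt, if_pos ⟨p, hap, hpa, hpc, hwp⟩, Nat.cast_inj] at hl
  set S := {m : ℕ | ∃ q : ℕ, a ≤ q ∧ q < a' ∧ BWT q = c ∧ 0 ≤ w q ∧ (m : ℤ) = w q} with hS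
  have hbdd : BddAbove S := by
    refine ((Finset.Ico a a').image fun q => (w q).toNat).bddAbove.mono ?_
    rintro m ⟨q, h₁, h₂, -, -, h⟩
    simp only [Finset.coe_image, Set.mem_image, Finset.mem_coe, Finset.mem_Ico]
    exact ⟨q, ⟨h₁, h₂⟩, by omega⟩
  have hmem : (w p).toNat ∈ S := ⟨p, hap, hpa, hpc, hwp, by omega⟩
  obtain ⟨q, h₁, h₂, h₃, -, h⟩ := Nat.sSup_mem ⟨_, hmem⟩ hbdd
  have hle := le_csSup hbdd hmem
  have hlm : l ∈ {p : ℕ | a ≤ p ∧ p < a' ∧ BWT p = c ∧ w p = wMax BWT w c a a'} := by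
    rw [hl]
    exact Nat.sInf_mem ⟨q, h₁, h₂, h₃, h.symm⟩
  obtain ⟨h₄, h₅, -, h₆⟩ := hlm
  rw [wMax, ← hS] at h₆
  exact ⟨h₄, h₅, by omega⟩

theorem bIdx_spec {L : ℕ → ℤ} {x : ℕ} (hx : 1 < x) (hL : L 1 < L x) :
    1 ≤ bIdx L x ∧ bIdx L x < x ∧ L (bIdx L x) < L x := by
  have hmem : bIdx L x ∈ {y : ℕ | (1 ≤ y ∧ y < x ∧ L y < L x) ∨ y = 1} :=
    Nat.sSup_mem ⟨1, Or.inr rfl⟩ ⟨x, by rintro y (h | h) <;> omega⟩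
  rcases hmem with ⟨h₁, h₂, h₃⟩ | h
  · exact ⟨h₁, h₂, h₃⟩
  · exact ⟨h.ge, by omega, by rwa [h]⟩

theorem eIdx_spec {L : ℕ → ℤ} {n x : ℕ} (hx : x ≤ n) :
    x < eIdx L n x ∧ eIdx L n x ≤ n + 1 ∧ (eIdx L n x ≤ n → L (eIdx L n x) < L x) := by
  have hmem : eIdx L n x ∈ {y : ℕ | (x < y ∧ y ≤ n ∧ L y < L x) ∨ y = n + 1} :=
    Nat.sInf_mem ⟨n + 1, Or.inr rfl⟩
  have hle : eIdx L n x ≤ n + 1 := Nat.sInf_le (Or.inr rfl)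
  rcases hmem with ⟨h₁, h₂, h₃⟩ | h
  · exact ⟨h₁, hle, fun _ => h₃⟩
  · exact ⟨by omega, hle, by omega⟩

/-- Let `x` with `1 < x ≤ n` and `BWT[x] ≠ BWT[x-1]`, `c ∈ {BWT[x], BWT[x-1]}`,
and `ℓ := Candt_c(b(x), e(x))`. Then `s(ℓ) ≥ b(x)` and `t(ℓ) < e(x)`. -/
theorem stmt5 (n σ : ℕ) (T : ℕ → ℤ) (dollar : ℤ) (SA : ℕ → ℕ) (BWT LCP w : ℕ → ℤ)
    (hsetup : FullSetup n σ T dollar SA BWT LCP w)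
    (x : ℕ) (hx1 : 1 < x) (hxn : x ≤ n) (hrun : BWT x ≠ BWT (x - 1))
    (c : ℤ) (hc : c = BWT x ∨ c = BWT (x - 1))
    (l : ℕ) (hl : (l : ℤ) = Candt BWT w c (bIdx LCP x) (eIdx LCP n x)) :
    bIdx LCP x ≤ sIdx T n SA w l ∧ tIdx T n SA w l < eIdx LCP n x := by
  have hS := hsetup.toLCPSetup
  obtain ⟨k, hk⟩ : ∃ k : ℕ, LCP x = k := ⟨_, hS.hLCP x hx1 hxn⟩
  obtain ⟨hb₁, hbx, hLb⟩ := bIdx_spec (L := LCP) hx1 (by rw [hS.hLCP1]; omega)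
  obtain ⟨hxe, hen, hLe⟩ := eIdx_spec (L := LCP) hxn
  set b := bIdx LCP x
  set e := eIdx LCP n x
  have hcx : CommonSuffix T (n - SA (x - 1)) (n - SA x) k :=
    (hS.le_LCP_iff hx1 hxn k).1 hk.ge
  obtain ⟨p, hbp, hpe, hpc, hwp⟩ : ∃ p, b ≤ p ∧ p < e ∧ BWT p = c ∧ (k : ℤ) ≤ w p := by
    rcases hc with rfl | rfl
    · exact ⟨x, hbx.le, hxe, rfl, hsetup.le_weight (by omega) hxn (z := x - 1) (by omega)
        (by omega) hrun (Or.inl ⟨hx1, hrun⟩) hcx.symm⟩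
    · refine ⟨x - 1, by omega, by omega, rfl, hsetup.le_weight (by omega) (by omega) (z := x)
        (by omega) hxn hrun.symm (Or.inr ⟨by omega, ?_⟩) hcx⟩
      rw [Nat.sub_add_cancel hx1.le]
      exact hrun.symm
  obtain ⟨hbl, hle, hwl⟩ := Candt_spec hl hbp hpe hpc (by omega)
  have hwn := hsetup.weight_le (y := l) (by omega) (by omega)
  set S := {i : ℕ | 1 ≤ i ∧ i ≤ n ∧
    seg T (n - SA l + 1 - (w l).toNat) (w l).toNat <:+ seg T 1 (n - SA i)}
  have hlS : l ∈ S := ⟨by omega, by omega, (seg_isSuffix_iff T hwn _).2 (.refl T hwn)⟩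
  have hSsub : ∀ i ∈ S, b ≤ i ∧ i < e := by
    rintro i ⟨hi, hin, hs⟩
    have hli := ((seg_isSuffix_iff T hwn _).1 hs).mono (m := k) (by omega)
    constructor
    · by_contra! hib
      have := hS.le_LCP_of_commonSuffix hi hib hbl (by omega) hli.symm
      omega
    · by_contra! hei
      have := hS.le_LCP_of_commonSuffix (by omega) hle hei hin hli
      have := hLe (by omega)
      omega
  exact ⟨(hSsub _ (Nat.sInf_mem ⟨l, hlS⟩)).1,
    (hSsub _ (Nat.sSup_mem ⟨l, hlS⟩ ⟨n, fun i hi => hi.2.1⟩)).2⟩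
end
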